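/- Let 0 < μ_j ≤ 1, j_r < 0, let m : [0,∞) → ℝ be continuous with μ_j² ≤ m(η) ≤ 1 for all η ≥ 0, and let θ : [0,∞) → ℝ be twice continuously differentiable with θ''(η) = m(η)·θ(η) for all η ≥ 0, θ'(0) = j_r, and θ(η) → 0, θ'(η) → 0 as η → ∞. Then θ(η) > 0 and j_r ≤ θ'(η) < 0 for all η ≥ 0. -/

import Mathlib

/-- A function with nonnegative derivative on `[0,∞)` is monotone there. -/
theorem monotoneOn_Ici_of_hasDerivWithinAt_nonneg {f f' : ℝ → ℝ}
    (hf : ∀ x ≥ (0 : ℝ), HasDerivWithinAt f (f' x) (Set.Ici 0) x)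
    (hf' : ∀ x ≥ (0 : ℝ), 0 ≤ f' x) : MonotoneOn f (Set.Ici 0) := by
  refine monotoneOn_of_hasDerivWithinAt_nonneg (convex_Ici 0)
    (fun x hx => (hf x hx).continuousWithinAt) (f' := f') ?_ ?_
  · exact fun x hx => (hf x (interior_subset hx)).mono interior_subset
  · exact fun x hx => hf' x (interior_subset hx)

/-- A solution of `u'' = m u` with `0 < m ≤ 1` that decays together with its derivative and has
negative initial slope is positive and nonincreasing, with slope increasing strictly to zero. -/
theorem pos_and_slope_neg_of_decaying {u v m : ℝ → ℝ}
    (hu : ∀ x ≥ (0 : ℝ), HasDerivWithinAt u (v x) (Set.Ici 0) x)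
    (hv : ∀ x ≥ (0 : ℝ), HasDerivWithinAt v (m x * u x) (Set.Ici 0) x)
    (hm0 : ∀ x ≥ (0 : ℝ), 0 < m x) (hm1 : ∀ x ≥ (0 : ℝ), m x ≤ 1) (hv0 : v 0 < 0)
    (hulim : Filter.Tendsto u Filter.atTop (nhds 0))
    (hvlim : Filter.Tendsto v Filter.atTop (nhds 0)) :
    ∀ x ≥ (0 : ℝ), 0 < u x ∧ v 0 ≤ v x ∧ v x < 0 := by
  have prod_mono : MonotoneOn (fun x => u x * v x) (Set.Ici 0) :=
    monotoneOn_Ici_of_hasDerivWithinAt_nonneg (fun x hx => (hu x hx).mul (hv x hx))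
      (fun x hx => by nlinarith [mul_nonneg (hm0 x hx).le (sq_nonneg (u x)), sq_nonneg (v x)])
  have prod_nonpos : ∀ x ≥ (0 : ℝ), u x * v x ≤ 0 := by
    intro x hx
    have hlim : Filter.Tendsto (fun y => u y * v y) Filter.atTop (nhds 0) := by
      simpa using hulim.mul hvlim
    refine ge_of_tendsto hlim ?_
    filter_upwards [Filter.eventually_ge_atTop x] with y hy
    exact prod_mono hx (hx.le.trans hy) hy
  have sq_anti : MonotoneOn (fun x => -(u x ^ 2)) (Set.Ici 0) :=
    monotoneOn_Ici_of_hasDerivWithinAt_nonneg (fun x hx => ((hu x hx).pow 2).neg)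
      (fun x hx => by norm_num; nlinarith [prod_nonpos x hx])
  have energy_mono :
      MonotoneOn (fun x => Real.exp (2 * x) * (u x ^ 2 + v x ^ 2)) (Set.Ici 0) := by
    refine monotoneOn_Ici_of_hasDerivWithinAt_nonneg
      (f' := fun x => Real.exp (2 * x) *
        (2 * (u x ^ 2 + v x ^ 2) + 2 * (1 + m x) * (u x * v x))) (fun x hx => ?_) (fun x hx => ?_)
    · have hexp : HasDerivWithinAt (fun y : ℝ => Real.exp (2 * y)) (Real.exp (2 * x) * (2 * 1))
          (Set.Ici 0) x := (((hasDerivAt_id x).const_mul 2).exp).hasDerivWithinAt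
      refine (hexp.mul (((hu x hx).pow 2).add ((hv x hx).pow 2))).congr_deriv ?_
      simp
      ring
    · refine mul_nonneg (Real.exp_pos _).le ?_
      nlinarith [sq_nonneg (u x + v x), mul_nonneg (sub_nonneg.2 (hm1 x hx))
        (neg_nonneg.2 (prod_nonpos x hx))]
  have energy_pos : ∀ x ≥ (0 : ℝ), 0 < u x ^ 2 + v x ^ 2 := by
    intro x hx
    have h := energy_mono Set.self_mem_Ici hx hx
    simp only [mul_zero, Real.exp_zero, one_mul] at h
    have h0 : 0 < u 0 ^ 2 + v 0 ^ 2 := by nlinarith [sq_nonneg (u 0)]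
    exact pos_of_mul_pos_right (h0.trans_le h) (Real.exp_pos _).le
  have u_ne_zero : ∀ x ≥ (0 : ℝ), u x ≠ 0 := by
    intro x hx hux
    have hzero : ∀ y ≥ x, u y = 0 := by
      intro y hy
      have h := sq_anti hx (hx.le.trans hy) hy
      simp only [hux] at h
      exact pow_eq_zero_iff two_ne_zero |>.1 (le_antisymm (by linarith) (sq_nonneg (u y)))
    have hx1 : (0 : ℝ) < x + 1 := by linarith [hx.le]
    have hd : HasDerivAt u (v (x + 1)) (x + 1) :=
      (hu _ hx1.le).hasDerivAt (Ici_mem_nhds hx1)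
    have heq : u =ᶠ[nhds (x + 1)] fun _ => (0 : ℝ) := by
      filter_upwards [Ici_mem_nhds (lt_add_one x)] with y hy using hzero y hy
    have hv1 : v (x + 1) = 0 := hd.unique ((hasDerivAt_const _ _).congr_of_eventuallyEq heq)
    have h := energy_pos (x + 1) hx1.le
    simp [hv1, hzero (x + 1) (by linarith)] at h
  have u_pos : ∀ x ≥ (0 : ℝ), 0 < u x := by
    intro x hx
    by_contra! hneg
    have h0 : 0 ≤ u 0 := by
      by_contra! h
      nlinarith [prod_nonpos 0 le_rfl, mul_pos_of_neg_of_neg h hv0]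
    have hcont : ContinuousOn u (Set.Icc 0 x) := fun y hy =>
      (hu y hy.1).continuousWithinAt.mono Set.Icc_subset_Ici_self
    obtain ⟨c, hc, huc⟩ := intermediate_value_Icc' hx hcont ⟨hneg, h0⟩
    exact u_ne_zero c hc.1 huc
  have v_strictMono : StrictMonoOn v (Set.Ici 0) := by
    refine strictMonoOn_of_hasDerivWithinAt_pos (convex_Ici 0)
      (fun x hx => (hv x hx).continuousWithinAt) (f' := fun x => m x * u x) ?_ ?_
    · exact fun x hx => (hv x (interior_subset hx)).mono interior_subset
    · exact fun x hx => mul_pos (hm0 x (interior_subset hx)) (u_pos x (interior_subset hx))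
  intro x hx
  have hx1 : (0 : ℝ) ≤ x + 1 := by linarith [hx.le]
  refine ⟨u_pos x hx, v_strictMono.monotoneOn Set.self_mem_Ici hx hx, ?_⟩
  exact (v_strictMono hx hx1 (lt_add_one x)).trans_le
    (nonpos_of_mul_nonpos_right (prod_nonpos _ hx1) (u_pos _ hx1))

/-- Positivity and monotonicity of the boundary-layer potential: if `θ'' = m·θ` on
`[0,∞)` with `μ_j² ≤ m ≤ 1`, `θ'(0) = j_r < 0` and `θ, θ' → 0` at infinity, then
`θ > 0` and `j_r ≤ θ' < 0` on `[0,∞)`. -/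
theorem potential_positive_decreasing (μj jr : ℝ) (hμj0 : 0 < μj) (hμj1 : μj ≤ 1)
    (hjr : jr < 0) (m θ : ℝ → ℝ)
    (hm : ContinuousOn m (Set.Ici (0 : ℝ)))
    (hmb : ∀ η ≥ (0 : ℝ), μj ^ 2 ≤ m η ∧ m η ≤ 1)
    (hθ : ContDiffOn ℝ 2 θ (Set.Ici (0 : ℝ)))
    (hode : ∀ η ≥ (0 : ℝ),
      derivWithin (derivWithin θ (Set.Ici (0 : ℝ))) (Set.Ici (0 : ℝ)) η = m η * θ η)
    (hθ0 : derivWithin θ (Set.Ici (0 : ℝ)) 0 = jr)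
    (hlim : Filter.Tendsto θ Filter.atTop (nhds 0))
    (hlim' : Filter.Tendsto (derivWithin θ (Set.Ici (0 : ℝ))) Filter.atTop (nhds 0)) :
    ∀ η ≥ (0 : ℝ), 0 < θ η ∧ jr ≤ derivWithin θ (Set.Ici (0 : ℝ)) η ∧
      derivWithin θ (Set.Ici (0 : ℝ)) η < 0 := by
  have hu : ∀ x ≥ (0 : ℝ), HasDerivWithinAt θ (derivWithin θ (Set.Ici 0) x) (Set.Ici 0) x :=
    fun x hx => (hθ.differentiableOn two_ne_zero x hx).hasDerivWithinAt
  have hθ' : ContDiffOn ℝ 1 (derivWithin θ (Set.Ici 0)) (Set.Ici 0) :=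
    hθ.derivWithin (uniqueDiffOn_Ici 0) (by norm_num)
  have hv : ∀ x ≥ (0 : ℝ),
      HasDerivWithinAt (derivWithin θ (Set.Ici 0)) (m x * θ x) (Set.Ici 0) x := fun x hx =>
    hode x hx ▸ (hθ'.differentiableOn one_ne_zero x hx).hasDerivWithinAt
  subst hθ0
  exact pos_and_slope_neg_of_decaying hu hv (fun x hx => (pow_pos hμj0 2).trans_le (hmb x hx).1)
    (fun x hx => (hmb x hx).2) hjr hlim hlim'
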